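/- arXiv:0905.0370 — 2 statements merged into one kernel-verified Lean document; each statement's English description precedes it below -/
import Mathlib

section
/- Let Ω ⊂ ℝⁿ be open, 0 < α ≤ 1, and let v ∈ C^{1,α}(Ω; ℝ^m) be such that the pullback metric v^♯e is of class C². Let φ ∈ C_c^∞(ℝⁿ) be a symmetric convolution kernel with ∫φ = 1, and set φ_ℓ(x) = ℓ^{−n} φ(x/ℓ). Then for every compact set K ⊂ Ω there is a constant C such that for all small ℓ > 0, ‖(v*φ_ℓ)^♯e − v^♯e‖_{C¹(K)} ≤ C ℓ^{2α−1}; more precisely ‖(v*φ_ℓ)^♯e − v^♯e‖_{C¹(K)} ≤ C (ℓ^{2α−1}‖v‖_{C^{1,α}}² + ℓ ‖v^♯e‖_{C²}). -/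
open scoped RealInnerProductSpace
open Set MeasureTheory

noncomputable section

/-- The pullback metric `(v^♯e)_{ij} = ∂_i v · ∂_j v` (derivatives on the open
set where `v` is differentiable). -/
def pullbackE {n m : ℕ} (v : EuclideanSpace ℝ (Fin n) → EuclideanSpace ℝ (Fin m))
    (x : EuclideanSpace ℝ (Fin n)) : Matrix (Fin n) (Fin n) ℝ :=
  Matrix.of fun i j =>
    ⟪fderiv ℝ v x (EuclideanSpace.single i 1), fderiv ℝ v x (EuclideanSpace.single j 1)⟫

/-- Componentwise convolution `(φ ⋆ v)(x) = ∫ φ(x − y) v(y) dy`. -/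
def convVec {n m : ℕ} (φ : EuclideanSpace ℝ (Fin n) → ℝ)
    (v : EuclideanSpace ℝ (Fin n) → EuclideanSpace ℝ (Fin m))
    (x : EuclideanSpace ℝ (Fin n)) : EuclideanSpace ℝ (Fin m) :=
  ∫ y, φ (x - y) • v y

/-- The rescaled kernel `φ_ℓ(x) = ℓ^{-n} φ(x/ℓ)`. -/
def moll {n : ℕ} (φ : EuclideanSpace ℝ (Fin n) → ℝ) (ℓ : ℝ)
    (x : EuclideanSpace ℝ (Fin n)) : ℝ :=
  (ℓ ^ n)⁻¹ * φ (ℓ⁻¹ • x)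

/-- The `C¹` norm over `K` of a matrix-valued field: sup of the entries plus
sup of the first derivatives of the entries. -/
def matC1On {n : ℕ} (K : Set (EuclideanSpace ℝ (Fin n)))
    (G : EuclideanSpace ℝ (Fin n) → Matrix (Fin n) (Fin n) ℝ) : ℝ :=
  (⨆ x : K, ⨆ i, ⨆ j, |G x i j|) +
    ⨆ x : K, ⨆ i, ⨆ j, ‖fderiv ℝ (fun y => G y i j) x‖

/-- The `C^{1,α}` norm of `v` on `s`. -/
def C1HolderNorm {n m : ℕ} (α : ℝ) (s : Set (EuclideanSpace ℝ (Fin n)))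
    (v : EuclideanSpace ℝ (Fin n) → EuclideanSpace ℝ (Fin m)) : ℝ :=
  (⨆ x : s, ‖v x‖) + (⨆ x : s, ‖fderiv ℝ v x‖) +
    ⨆ p : ↥(s ×ˢ s), ‖fderiv ℝ v (p : EuclideanSpace ℝ (Fin n) × EuclideanSpace ℝ (Fin n)).1
        - fderiv ℝ v (p : EuclideanSpace ℝ (Fin n) × EuclideanSpace ℝ (Fin n)).2‖ /
      ‖(p : EuclideanSpace ℝ (Fin n) × EuclideanSpace ℝ (Fin n)).1 -
        (p : EuclideanSpace ℝ (Fin n) × EuclideanSpace ℝ (Fin n)).2‖ ^ α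

/-- The `C²` norm on `Ω` of the (matrix-valued) pullback metric of `v`. -/
def pbC2Norm {n m : ℕ} (Ω : Set (EuclideanSpace ℝ (Fin n)))
    (v : EuclideanSpace ℝ (Fin n) → EuclideanSpace ℝ (Fin m)) : ℝ :=
  ∑ k ∈ Finset.range 3, ⨆ x : Ω, ⨆ i, ⨆ j,
    ‖iteratedFDeriv ℝ k (fun y => pullbackE v y i j) x‖

open scoped Convolution Manifold ContDiff

section WeightedAverages

variable {X F : Type*} [MeasurableSpace X] {μ : Measure X}
  [NormedAddCommGroup F] [InnerProductSpace ℝ F]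

lemma norm_integral_smul_le_integral_abs_mul {q : X → ℝ} {f : X → F} {S : ℝ}
    (hq : Integrable q μ) (h : ∀ y, q y ≠ 0 → ‖f y‖ ≤ S) :
    ‖∫ y, q y • f y ∂μ‖ ≤ (∫ y, |q y| ∂μ) * S := by
  rw [← integral_mul_const]
  refine norm_integral_le_of_norm_le (hq.abs.mul_const S) (.of_forall fun y => ?_)
  rw [norm_smul, Real.norm_eq_abs]
  by_cases hy : q y = 0
  · simp [hy]
  · exact mul_le_mul_of_nonneg_left (h y hy) (abs_nonneg _)

lemma integral_smul_sub_const [CompleteSpace F] {q : X → ℝ} {f : X → F} (hq : Integrable q μ)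
    (hf : Integrable (fun y => q y • f y) μ) (c : F) :
    ∫ y, q y • (f y - c) ∂μ = (∫ y, q y • f y ∂μ) - (∫ y, q y ∂μ) • c := by
  simp_rw [smul_sub]
  rw [integral_sub hf (hq.smul_const c), integral_smul_const]

lemma integral_smul_inner_sub_const [CompleteSpace F] {q : X → ℝ} {a b : X → F}
    (hq : Integrable q μ)
    (ha : Integrable (fun y => q y • a y) μ) (hb : Integrable (fun y => q y • b y) μ)
    (hab : Integrable (fun y => q y • ⟪a y, b y⟫) μ) (a₀ b₀ : F) :
    ∫ y, q y • ⟪a y - a₀, b y - b₀⟫ ∂μ =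
      (∫ y, q y • ⟪a y, b y⟫ ∂μ) - ⟪a₀, ∫ y, q y • b y ∂μ⟫ - ⟪∫ y, q y • a y ∂μ, b₀⟫
        + (∫ y, q y ∂μ) * ⟪a₀, b₀⟫ := by
  have h1 : ∀ y, q y • ⟪a y - a₀, b y - b₀⟫ =
      q y • ⟪a y, b y⟫ - ⟪a₀, q y • b y⟫ - ⟪b₀, q y • a y⟫ + q y * ⟪a₀, b₀⟫ := fun y => by
    rw [real_inner_comm (q y • a y) b₀]
    simp only [inner_sub_left, inner_sub_right, real_inner_smul_left, real_inner_smul_right,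
      smul_eq_mul]
    ring
  have h2 : Integrable (fun y => q y • ⟪a y, b y⟫ - ⟪a₀, q y • b y⟫) μ :=
    hab.sub (hb.const_inner a₀)
  have h3 : Integrable (fun y => q y • ⟪a y, b y⟫ - ⟪a₀, q y • b y⟫ - ⟪b₀, q y • a y⟫) μ :=
    h2.sub (ha.const_inner b₀)
  simp_rw [h1]
  rw [integral_add h3 (hq.mul_const _), integral_sub h2 (ha.const_inner b₀),
    integral_sub hab (hb.const_inner a₀), integral_inner hb, integral_inner ha,
    integral_mul_const, real_inner_comm _ b₀]

/-- The commutator of averaging and taking inner products is quadratic in the oscillation. -/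
lemma abs_inner_integral_sub_integral_inner_le [CompleteSpace F] {p : X → ℝ} {a b : X → F}
    {a₀ b₀ : F} {S : ℝ} (hp : Integrable p μ) (hp1 : ∫ y, p y ∂μ = 1)
    (ha : Integrable (fun y => p y • a y) μ) (hb : Integrable (fun y => p y • b y) μ)
    (hab : Integrable (fun y => p y • ⟪a y, b y⟫) μ)
    (haS : ∀ y, p y ≠ 0 → ‖a y - a₀‖ ≤ S) (hbS : ∀ y, p y ≠ 0 → ‖b y - b₀‖ ≤ S) :
    |⟪∫ y, p y • a y ∂μ, ∫ y, p y • b y ∂μ⟫ - ∫ y, p y • ⟪a y, b y⟫ ∂μ| ≤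
      (∫ y, |p y| ∂μ) ^ 2 * S ^ 2 + (∫ y, |p y| ∂μ) * S ^ 2 := by
  have key : ⟪∫ y, p y • a y ∂μ, ∫ y, p y • b y ∂μ⟫ - ∫ y, p y • ⟪a y, b y⟫ ∂μ =
      ⟪∫ y, p y • (a y - a₀) ∂μ, ∫ y, p y • (b y - b₀) ∂μ⟫
        - ∫ y, p y • ⟪a y - a₀, b y - b₀⟫ ∂μ := by
    rw [integral_smul_inner_sub_const hp ha hb hab, integral_smul_sub_const hp ha,
      integral_smul_sub_const hp hb, hp1]
    simp only [inner_sub_left, inner_sub_right, one_smul]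
    ring
  have hA := norm_integral_smul_le_integral_abs_mul hp haS
  have hB := norm_integral_smul_le_integral_abs_mul hp hbS
  have hAB := norm_integral_smul_le_integral_abs_mul (f := fun y => ⟪a y - a₀, b y - b₀⟫)
    (S := S * S) hp fun y hy => (norm_inner_le_norm _ _).trans <|
      mul_le_mul (haS y hy) (hbS y hy) (norm_nonneg _) ((norm_nonneg _).trans (haS y hy))
  rw [key, ← Real.norm_eq_abs]
  calc _ ≤ _ := norm_sub_le _ _
    _ ≤ ((∫ y, |p y| ∂μ) * S) * ((∫ y, |p y| ∂μ) * S) + (∫ y, |p y| ∂μ) * (S * S) :=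
      add_le_add ((norm_inner_le_norm _ _).trans <|
        mul_le_mul hA hB (norm_nonneg _) ((norm_nonneg _).trans hA)) hAB
    _ = _ := by ring

/-- The derivative version of `abs_inner_integral_sub_integral_inner_le`, where `q` plays the role
of a derivative of the weight `p`. -/
lemma abs_inner_integral_add_sub_integral_inner_le [CompleteSpace F] {p q : X → ℝ}
    {a b : X → F} {a₀ b₀ : F} {S : ℝ} (hp : Integrable p μ) (hp1 : ∫ y, p y ∂μ = 1)
    (hpa : Integrable (fun y => p y • a y) μ) (hpb : Integrable (fun y => p y • b y) μ)
    (hq : Integrable q μ) (hq0 : ∫ y, q y ∂μ = 0)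
    (hqa : Integrable (fun y => q y • a y) μ) (hqb : Integrable (fun y => q y • b y) μ)
    (hab : Integrable (fun y => q y • ⟪a y, b y⟫) μ)
    (hpaS : ∀ y, p y ≠ 0 → ‖a y - a₀‖ ≤ S) (hpbS : ∀ y, p y ≠ 0 → ‖b y - b₀‖ ≤ S)
    (hqaS : ∀ y, q y ≠ 0 → ‖a y - a₀‖ ≤ S) (hqbS : ∀ y, q y ≠ 0 → ‖b y - b₀‖ ≤ S) :
    |⟪∫ y, p y • a y ∂μ, ∫ y, q y • b y ∂μ⟫ + ⟪∫ y, q y • a y ∂μ, ∫ y, p y • b y ∂μ⟫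
        - ∫ y, q y • ⟪a y, b y⟫ ∂μ| ≤
      (∫ y, |q y| ∂μ) * (2 * (∫ y, |p y| ∂μ) + 1) * S ^ 2 := by
  have key : ⟪∫ y, p y • a y ∂μ, ∫ y, q y • b y ∂μ⟫ + ⟪∫ y, q y • a y ∂μ, ∫ y, p y • b y ∂μ⟫
        - ∫ y, q y • ⟪a y, b y⟫ ∂μ =
      ⟪∫ y, p y • (a y - a₀) ∂μ, ∫ y, q y • (b y - b₀) ∂μ⟫
        + ⟪∫ y, q y • (a y - a₀) ∂μ, ∫ y, p y • (b y - b₀) ∂μ⟫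
        - ∫ y, q y • ⟪a y - a₀, b y - b₀⟫ ∂μ := by
    rw [integral_smul_inner_sub_const hq hqa hqb hab, integral_smul_sub_const hp hpa,
      integral_smul_sub_const hp hpb, integral_smul_sub_const hq hqa,
      integral_smul_sub_const hq hqb, hp1, hq0]
    simp only [inner_sub_left, inner_sub_right, one_smul, zero_smul, sub_zero]
    ring
  have hpA := norm_integral_smul_le_integral_abs_mul hp hpaS
  have hpB := norm_integral_smul_le_integral_abs_mul hp hpbS
  have hqA := norm_integral_smul_le_integral_abs_mul hq hqaS
  have hqB := norm_integral_smul_le_integral_abs_mul hq hqbS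
  have hAB := norm_integral_smul_le_integral_abs_mul (f := fun y => ⟪a y - a₀, b y - b₀⟫)
    (S := S * S) hq fun y hy => (norm_inner_le_norm _ _).trans <|
      mul_le_mul (hqaS y hy) (hqbS y hy) (norm_nonneg _) ((norm_nonneg _).trans (hqaS y hy))
  rw [key, ← Real.norm_eq_abs]
  calc _ ≤ _ := (norm_sub_le _ _).trans (add_le_add_left (norm_add_le _ _) _)
    _ ≤ ((∫ y, |p y| ∂μ) * S) * ((∫ y, |q y| ∂μ) * S)
        + ((∫ y, |q y| ∂μ) * S) * ((∫ y, |p y| ∂μ) * S) + (∫ y, |q y| ∂μ) * (S * S) :=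
      add_le_add (add_le_add
        ((norm_inner_le_norm _ _).trans <|
          mul_le_mul hpA hqB (norm_nonneg _) ((norm_nonneg _).trans hpA))
        ((norm_inner_le_norm _ _).trans <|
          mul_le_mul hqA hpB (norm_nonneg _) ((norm_nonneg _).trans hqA))) hAB
    _ = _ := by ring

end WeightedAverages

section Convolution

variable {E F : Type*} [NormedAddCommGroup E] [NormedSpace ℝ E]
  [MeasurableSpace E] [BorelSpace E] {μ : Measure E} [μ.IsAddHaarMeasure]
  [NormedAddCommGroup F] [NormedSpace ℝ F]

lemma integrable_comp_sub_left_smul [FiniteDimensional ℝ E] {q : E → ℝ} {f : E → F}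
    (hq : Continuous q) (hqs : HasCompactSupport q) (hf : Continuous f) (x : E) :
    Integrable (fun y => q (x - y) • f y) μ :=
  Continuous.integrable_of_hasCompactSupport (by fun_prop)
    ((hqs.comp_homeomorph (Homeomorph.subLeft x)).smul_right)

/-- Differentiating `∫ ψ(x - y) f(y) dy` on the kernel. -/
lemma exists_hasFDerivAt_integral_kernel [FiniteDimensional ℝ E] {ψ : E → ℝ} {f : E → F}
    (hψ : ContDiff ℝ 1 ψ) (hψs : HasCompactSupport ψ) (hf : Continuous f) (x : E) :
    ∃ L : E →L[ℝ] F, HasFDerivAt (fun x => ∫ y, ψ (x - y) • f y ∂μ) L x ∧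
      ∀ w, L w = ∫ y, fderiv ℝ ψ (x - y) w • f y ∂μ := by
  let B : F →L[ℝ] ℝ →L[ℝ] F := (ContinuousLinearMap.lsmul ℝ ℝ).flip
  refine ⟨_, hψs.hasFDerivAt_convolution_right B hf.locallyIntegrable hψ x, fun w => ?_⟩
  rw [convolution_precompR_apply B hf.locallyIntegrable (hψs.fderiv ℝ)
    (hψ.continuous_fderiv one_ne_zero)]
  rfl

/-- Differentiating `∫ ψ(x - y) f(y) dy` on the function. -/
lemma exists_hasFDerivAt_integral_function [FiniteDimensional ℝ E] {ψ : E → ℝ} {f : E → F}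
    (hψ : Continuous ψ)
    (hf : ContDiff ℝ 1 f) (hfs : HasCompactSupport f) (x : E) :
    ∃ L : E →L[ℝ] F, HasFDerivAt (fun x => ∫ y, ψ (x - y) • f y ∂μ) L x ∧
      ∀ w, L w = ∫ y, ψ (x - y) • fderiv ℝ f y w ∂μ := by
  let B : ℝ →L[ℝ] F →L[ℝ] F := ContinuousLinearMap.lsmul ℝ ℝ
  have hfun : (fun x => ∫ y, ψ (x - y) • f y ∂μ) = ψ ⋆[B, μ] f := by
    ext x; rw [convolution_eq_swap]; rfl
  refine ⟨_, hfun ▸ hfs.hasFDerivAt_convolution_right B hψ.locallyIntegrable hf x, fun w => ?_⟩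
  rw [convolution_precompR_apply B hψ.locallyIntegrable (hfs.fderiv ℝ)
    (hf.continuous_fderiv one_ne_zero), convolution_eq_swap]
  rfl

lemma integral_fderiv_kernel_eq_zero [FiniteDimensional ℝ E] {ψ : E → ℝ}
    (hψ : ContDiff ℝ 1 ψ) (hψs : HasCompactSupport ψ) (x w : E) :
    ∫ y, fderiv ℝ ψ (x - y) w ∂μ = 0 := by
  obtain ⟨L, hL, hLw⟩ := exists_hasFDerivAt_integral_kernel (μ := μ) hψ hψs
    (continuous_const (y := (1 : ℝ))) x
  have hc : (fun x => ∫ y, ψ (x - y) • (1 : ℝ) ∂μ) = fun _ => ∫ y, ψ y ∂μ := by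
    ext x
    simpa using integral_sub_left_eq_self ψ μ x
  rw [hc] at hL
  simpa [hL.unique (hasFDerivAt_const _ _)] using (hLw w).symm

end Convolution

section MollifiedInner

variable {E F : Type*} [NormedAddCommGroup E] [NormedSpace ℝ E] [FiniteDimensional ℝ E]
  [MeasurableSpace E] [BorelSpace E] {μ : Measure E} [μ.IsAddHaarMeasure]
  [NormedAddCommGroup F] [InnerProductSpace ℝ F] [CompleteSpace F]

/-- If `⟪a, b⟫ = g` with `g` of class `C^{1,1}`, then the inner product of the mollifications of `a` and
`b` is `C¹`-close to `g`, quadratically in the oscillation `S` of `a` and `b`. -/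
lemma inner_mollification_estimate {ψ : E → ℝ} (hψ : ContDiff ℝ 1 ψ) (hψs : HasCompactSupport ψ)
    (hψ1 : ∫ y, ψ y ∂μ = 1) {r : ℝ} (hr0 : 0 ≤ r)
    (hr : tsupport ψ ⊆ Metric.closedBall 0 r) {M N : ℝ} (hN0 : 0 ≤ N) (hM : ∫ y, |ψ y| ∂μ = M)
    (hN : ∀ w, ∫ y, |fderiv ℝ ψ y w| ∂μ ≤ N * ‖w‖)
    {a b : E → F} (ha : Continuous a) (hb : Continuous b)
    {g : E → ℝ} (hg : ContDiff ℝ 1 g) (hgs : HasCompactSupport g) {Λ : ℝ} (hΛ : 0 ≤ Λ)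
    (hg0 : ∀ x y, ‖g x - g y‖ ≤ Λ * ‖x - y‖)
    (hg1 : ∀ x y, ‖fderiv ℝ g x - fderiv ℝ g y‖ ≤ Λ * ‖x - y‖)
    {x : E} {S : ℝ} (hab : ∀ y, ‖x - y‖ ≤ r → ⟪a y, b y⟫ = g y)
    (haS : ∀ y, ‖x - y‖ ≤ r → ‖a y - a x‖ ≤ S) (hbS : ∀ y, ‖x - y‖ ≤ r → ‖b y - b x‖ ≤ S) :
    |⟪∫ y, ψ (x - y) • a y ∂μ, ∫ y, ψ (x - y) • b y ∂μ⟫ - g x| ≤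
        (M ^ 2 + M) * S ^ 2 + M * Λ * r ∧
      ‖fderiv ℝ (fun x => ⟪∫ y, ψ (x - y) • a y ∂μ, ∫ y, ψ (x - y) • b y ∂μ⟫ - g x) x‖ ≤
        N * (2 * M + 1) * S ^ 2 + M * Λ * r := by
  have hψc : Continuous ψ := hψ.continuous
  have hM0 : 0 ≤ M := hM ▸ integral_nonneg fun _ => abs_nonneg _
  have hsupp : ∀ y, ψ (x - y) ≠ 0 → ‖x - y‖ ≤ r := fun y hy => by
    simpa using hr (subset_tsupport _ hy)
  have hsupp' : ∀ w y, fderiv ℝ ψ (x - y) w ≠ 0 → ‖x - y‖ ≤ r := fun w y hy => by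
    refine mem_closedBall_zero_iff.1 (hr (support_fderiv_subset ℝ ?_))
    rintro h
    simp [h] at hy
  have hψ1x : ∫ y, ψ (x - y) ∂μ = 1 := by rw [integral_sub_left_eq_self ψ μ x, hψ1]
  have hMx : ∫ y, |ψ (x - y)| ∂μ = M := by
    rw [integral_sub_left_eq_self (fun y => |ψ y|) μ x, hM]
  have hNx : ∀ w, ∫ y, |fderiv ℝ ψ (x - y) w| ∂μ ≤ N * ‖w‖ := fun w => by
    rw [integral_sub_left_eq_self (fun y => |fderiv ℝ ψ y w|) μ x]; exact hN w
  have hDc : ∀ w, Continuous fun z => fderiv ℝ ψ z w := fun w =>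
    (hψ.continuous_fderiv one_ne_zero).clm_apply continuous_const
  have hDs : ∀ w, HasCompactSupport fun z => fderiv ℝ ψ z w := fun w =>
    hψs.fderiv_apply ℝ w
  have hpI : Integrable (fun y => ψ (x - y)) μ := by
    simpa using integrable_comp_sub_left_smul (μ := μ) hψc hψs (continuous_const (y := (1 : ℝ))) x
  have hqI : ∀ w, Integrable (fun y => fderiv ℝ ψ (x - y) w) μ := fun w => by
    simpa using integrable_comp_sub_left_smul (μ := μ) (hDc w) (hDs w)
      (continuous_const (y := (1 : ℝ))) x
  have hmean : ∀ f : E → ℝ, Continuous f → ∀ c B : ℝ, (∀ y, ‖x - y‖ ≤ r → |f y - c| ≤ B) →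
      |(∫ y, ψ (x - y) • f y ∂μ) - c| ≤ M * B := fun f hf c B hB => by
    have h := integral_smul_sub_const hpI (integrable_comp_sub_left_smul hψc hψs hf x) c
    rw [hψ1x, one_smul] at h
    rw [← h, ← hMx, ← Real.norm_eq_abs]
    exact norm_integral_smul_le_integral_abs_mul hpI fun y hy => hB y (hsupp y hy)
  constructor
  · have h1 := abs_inner_integral_sub_integral_inner_le hpI hψ1x
      (integrable_comp_sub_left_smul hψc hψs ha x) (integrable_comp_sub_left_smul hψc hψs hb x)
      (integrable_comp_sub_left_smul hψc hψs (ha.inner hb) x)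
      (fun y hy => haS y (hsupp y hy)) (fun y hy => hbS y (hsupp y hy))
    have h2 : ∫ y, ψ (x - y) • ⟪a y, b y⟫ ∂μ = ∫ y, ψ (x - y) • g y ∂μ :=
      integral_congr_ae <| .of_forall fun y => by
        by_cases hy : ψ (x - y) = 0
        · simp [hy]
        · simp only [hab y (hsupp y hy)]
    have h3 := hmean g hg.continuous (g x) (Λ * r) fun y hy => by
      rw [← Real.norm_eq_abs]
      refine (hg0 y x).trans ?_
      rw [norm_sub_rev]
      gcongr
    rw [h2, hMx] at h1
    calc _ ≤ _ := abs_sub_le _ (∫ y, ψ (x - y) • g y ∂μ) _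
      _ ≤ _ := add_le_add h1 h3
      _ = _ := by ring
  · obtain ⟨La, hLa, hLaw⟩ := exists_hasFDerivAt_integral_kernel (μ := μ) hψ hψs ha x
    obtain ⟨Lb, hLb, hLbw⟩ := exists_hasFDerivAt_integral_kernel (μ := μ) hψ hψs hb x
    obtain ⟨L₁, hL₁, hL₁w⟩ := exists_hasFDerivAt_integral_kernel (μ := μ) hψ hψs hg.continuous x
    obtain ⟨L₂, hL₂, hL₂w⟩ := exists_hasFDerivAt_integral_function (μ := μ) hψc hg hgs x
    have hL : L₁ = L₂ := hL₁.unique hL₂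
    have hD := (hLa.inner ℝ hLb).fun_sub (hg.differentiable one_ne_zero x).hasFDerivAt
    rw [hD.fderiv]
    refine ContinuousLinearMap.opNorm_le_bound _ (by positivity) fun w => ?_
    have h1 := abs_inner_integral_add_sub_integral_inner_le hpI hψ1x
      (integrable_comp_sub_left_smul hψc hψs ha x) (integrable_comp_sub_left_smul hψc hψs hb x)
      (hqI w) (integral_fderiv_kernel_eq_zero hψ hψs x w)
      (integrable_comp_sub_left_smul (hDc w) (hDs w) ha x)
      (integrable_comp_sub_left_smul (hDc w) (hDs w) hb x)
      (integrable_comp_sub_left_smul (hDc w) (hDs w) (ha.inner hb) x)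
      (fun y hy => haS y (hsupp y hy)) (fun y hy => hbS y (hsupp y hy))
      (fun y hy => haS y (hsupp' w y hy)) (fun y hy => hbS y (hsupp' w y hy))
    have h2 : ∫ y, fderiv ℝ ψ (x - y) w • ⟪a y, b y⟫ ∂μ =
        ∫ y, ψ (x - y) • fderiv ℝ g y w ∂μ := by
      rw [← hL₂w, ← hL, hL₁w]
      refine integral_congr_ae <| .of_forall fun y => ?_
      by_cases hy : fderiv ℝ ψ (x - y) w = 0
      · simp [hy]
      · simp only [hab y (hsupp' w y hy)]
    have h3 := hmean (fun y => fderiv ℝ g y w)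
      ((hg.continuous_fderiv one_ne_zero).clm_apply continuous_const) (fderiv ℝ g x w)
      (Λ * r * ‖w‖) fun y hy => by
        rw [← Real.norm_eq_abs, ← sub_apply]
        refine (ContinuousLinearMap.le_of_opNorm_le _ ((hg1 y x).trans ?_) w)
        rw [norm_sub_rev]
        gcongr
    have h4 : (∫ y, |fderiv ℝ ψ (x - y) w| ∂μ) * (2 * M + 1) * S ^ 2 ≤
        N * ‖w‖ * (2 * M + 1) * S ^ 2 := by
      gcongr
      exact hNx w
    rw [h2, hMx] at h1
    simp only [sub_apply, ContinuousLinearMap.comp_apply,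
      ContinuousLinearMap.prod_apply, fderivInnerCLM_apply, hLaw, hLbw, Real.norm_eq_abs]
    calc _ ≤ _ := abs_sub_le _ (∫ y, ψ (x - y) • fderiv ℝ g y w ∂μ) _
      _ ≤ _ := add_le_add (h1.trans h4) h3
      _ = _ := by ring

end MollifiedInner

section Mollifier

variable {n : ℕ} {φ : EuclideanSpace ℝ (Fin n) → ℝ} {ℓ R : ℝ}

lemma contDiff_moll {k : WithTop ℕ∞} (hφ : ContDiff ℝ k φ) : ContDiff ℝ k (moll φ ℓ) :=
  contDiff_const.mul (hφ.comp (contDiff_const_smul _))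

lemma tsupport_moll_subset (hℓ : 0 < ℓ) (hφ : ∀ z, φ z ≠ 0 → ‖z‖ ≤ R) :
    tsupport (moll φ ℓ) ⊆ Metric.closedBall 0 (ℓ * R) := by
  refine closure_minimal (fun z hz => ?_) Metric.isClosed_closedBall
  have h := hφ _ (right_ne_zero_of_mul hz)
  rw [norm_smul, norm_inv, Real.norm_eq_abs, abs_of_pos hℓ, inv_mul_le_iff₀ hℓ] at h
  simpa using h

lemma integral_moll (hℓ : 0 < ℓ) : ∫ z, moll φ ℓ z = ∫ z, φ z := by
  have h := Measure.integral_comp_inv_smul_of_nonneg volume φ hℓ.le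
  rw [finrank_euclideanSpace_fin, smul_eq_mul] at h
  simp_rw [moll]
  rw [integral_const_mul, h, inv_mul_cancel_left₀ (pow_pos hℓ n).ne']

lemma integral_abs_moll (hℓ : 0 < ℓ) : ∫ z, |moll φ ℓ z| = ∫ z, |φ z| := by
  rw [← integral_moll (φ := fun z => |φ z|) hℓ]
  simp [moll, abs_mul, abs_of_pos hℓ]

lemma fderiv_moll (hφ : Differentiable ℝ φ) (z w : EuclideanSpace ℝ (Fin n)) :
    fderiv ℝ (moll φ ℓ) z w = ℓ⁻¹ * moll (fun z => fderiv ℝ φ z w) ℓ z := by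
  have h := ((hφ (ℓ⁻¹ • z)).hasFDerivAt.comp z
    ((hasFDerivAt_id z).const_smul ℓ⁻¹)).const_mul (ℓ ^ n)⁻¹
  rw [show fderiv ℝ (moll φ ℓ) z = _ from h.fderiv]
  simp [moll]
  ring

lemma integral_abs_fderiv_moll_le (hφ : ContDiff ℝ 1 φ) (hφs : HasCompactSupport φ)
    (hℓ : 0 < ℓ) (w : EuclideanSpace ℝ (Fin n)) :
    ∫ z, |fderiv ℝ (moll φ ℓ) z w| ≤ ℓ⁻¹ * (∫ z, ‖fderiv ℝ φ z‖) * ‖w‖ := by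
  have hI : Integrable (fun z => ‖fderiv ℝ φ z‖) :=
    ((hφ.continuous_fderiv one_ne_zero).integrable_of_hasCompactSupport (hφs.fderiv ℝ)).norm
  simp_rw [fderiv_moll (hφ.differentiable one_ne_zero), abs_mul, abs_of_pos (inv_pos.2 hℓ)]
  rw [integral_const_mul, integral_abs_moll hℓ, mul_assoc, ← integral_mul_const]
  refine mul_le_mul_of_nonneg_left ?_ (inv_nonneg.2 hℓ.le)
  exact integral_mono_of_nonneg (.of_forall fun _ => abs_nonneg _) (hI.mul_const _)
    (.of_forall fun z => (fderiv ℝ φ z).le_opNorm w)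

end Mollifier

section Cutoff

lemma mem_thickening_two_mul {E : Type*} [SeminormedAddCommGroup E] {K : Set E} {δ : ℝ}
    {x y : E} (hx : x ∈ Metric.thickening δ K) (hxy : ‖x - y‖ ≤ δ) : y ∈ Metric.thickening (2 * δ) K := by
  obtain ⟨z, hz, hxz⟩ := Metric.mem_thickening_iff.1 hx
  refine Metric.mem_thickening_iff.2 ⟨z, hz, ?_⟩
  have := dist_triangle y x z
  rw [dist_comm y x, dist_eq_norm x y] at this
  linarith

variable {E F : Type*} [NormedAddCommGroup E] [NormedSpace ℝ E]
  [NormedAddCommGroup F] [NormedSpace ℝ F]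

lemma contDiff_smul_of_tsupport_subset {k : WithTop ℕ∞} {Ω : Set E} (hΩ : IsOpen Ω) {χ : E → ℝ}
    (hχ : ContDiff ℝ k χ) (hχΩ : tsupport χ ⊆ Ω) {f : E → F} (hf : ContDiffOn ℝ k f Ω) :
    ContDiff ℝ k (fun x => χ x • f x) := by
  refine contDiff_iff_contDiffAt.2 fun x => ?_
  by_cases hx : x ∈ tsupport χ
  · exact hχ.contDiffAt.smul (hf.contDiffAt (hΩ.mem_nhds (hχΩ hx)))
  · refine (contDiffAt_const (c := (0 : F))).congr_of_eventuallyEq ?_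
    filter_upwards [notMem_tsupport_iff_eventuallyEq.1 hx] with y hy
    simp [hy]

lemma exists_cutoff [FiniteDimensional ℝ E] {K Ω : Set E} (hK : IsCompact K) (hΩ : IsOpen Ω)
    (hKΩ : K ⊆ Ω) :
    ∃ δ > (0 : ℝ), ∃ χ : E → ℝ, ContDiff ℝ ∞ χ ∧ HasCompactSupport χ ∧ tsupport χ ⊆ Ω ∧
      Metric.thickening (2 * δ) K ⊆ Ω ∧ ∀ x ∈ Metric.thickening (2 * δ) K, χ x = 1 := by
  have := FiniteDimensional.proper ℝ E
  obtain ⟨δ, hδ, hδΩ⟩ := hK.exists_cthickening_subset_open hΩ hKΩ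
  obtain ⟨χ, hχ, -, hsupp, hone⟩ := exists_contMDiff_support_eq_eq_one_iff (n := (⊤ : ℕ∞)) 𝓘(ℝ, E)
    (Metric.isOpen_thickening (δ := δ) (E := K))
    (Metric.isClosed_cthickening (δ := 2 * (δ / 4)) (E := K))
    (Metric.cthickening_subset_thickening' hδ (by linarith) K)
  have hts : tsupport χ ⊆ Metric.cthickening δ K := by
    rw [tsupport, hsupp]
    exact Metric.closure_thickening_subset_cthickening δ K
  exact ⟨δ / 4, by positivity, χ, hχ.contDiff, hK.cthickening.of_isClosed_subset
    (isClosed_tsupport χ) hts, hts.trans hδΩ,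
    (Metric.thickening_subset_cthickening_of_le (by linarith) K).trans hδΩ,
    fun x hx => (hone x).1 (Metric.thickening_subset_cthickening _ K hx)⟩

lemma ContDiff.exists_lipschitz_of_hasCompactSupport {f : E → F} (hf : ContDiff ℝ 1 f)
    (hfs : HasCompactSupport f) : ∃ C ≥ (0 : ℝ), ∀ x y, ‖f x - f y‖ ≤ C * ‖x - y‖ := by
  obtain ⟨C, hC⟩ := hf.lipschitzWith_of_hasCompactSupport hfs one_ne_zero
  exact ⟨C, C.2, fun x y => hC.norm_sub_le x y⟩

end Cutoff

section Main

variable {n m : ℕ}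

/-- Near `K`, the derivative of `v * ψ` is the mollification of the derivative of any `C¹`
compactly supported function agreeing with `v` near `K`. -/
lemma fderiv_convVec_apply {K : Set (EuclideanSpace ℝ (Fin n))} {δ : ℝ}
    {ψ : EuclideanSpace ℝ (Fin n) → ℝ} (hψ : Continuous ψ)
    (hψδ : tsupport ψ ⊆ Metric.closedBall 0 δ)
    {v v₀ : EuclideanSpace ℝ (Fin n) → EuclideanSpace ℝ (Fin m)} (hv₀ : ContDiff ℝ 1 v₀)
    (hv₀s : HasCompactSupport v₀) (hvv₀ : ∀ x ∈ Metric.thickening (2 * δ) K, v x = v₀ x)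
    {x : EuclideanSpace ℝ (Fin n)} (hx : x ∈ Metric.thickening δ K)
    (w : EuclideanSpace ℝ (Fin n)) :
    fderiv ℝ (convVec ψ v) x w = ∫ y, ψ (x - y) • fderiv ℝ v₀ y w := by
  obtain ⟨L, hL, hLw⟩ := exists_hasFDerivAt_integral_function (μ := volume) hψ hv₀ hv₀s x
  rw [← hLw, ← hL.fderiv]
  congr 1
  refine Filter.EventuallyEq.fderiv_eq ?_
  filter_upwards [Metric.isOpen_thickening.mem_nhds hx] with z hz
  refine integral_congr_ae <| .of_forall fun y => ?_
  by_cases hy : ψ (z - y) = 0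
  · simp [hy]
  · have : ‖z - y‖ ≤ δ := by simpa using hψδ (subset_tsupport _ hy)
    simp only [hvv₀ y (mem_thickening_two_mul hz this)]

lemma matC1On_le {K : Set (EuclideanSpace ℝ (Fin n))}
    {G : EuclideanSpace ℝ (Fin n) → Matrix (Fin n) (Fin n) ℝ} {A B : ℝ} (hA : 0 ≤ A) (hB : 0 ≤ B)
    (h0 : ∀ x ∈ K, ∀ i j, |G x i j| ≤ A)
    (h1 : ∀ x ∈ K, ∀ i j, ‖fderiv ℝ (fun y => G y i j) x‖ ≤ B) : matC1On K G ≤ A + B :=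
  add_le_add
    (Real.iSup_le (fun x => Real.iSup_le (fun i => Real.iSup_le (h0 x x.2 i) hA) hA) hA)
    (Real.iSup_le (fun x => Real.iSup_le (fun i => Real.iSup_le (h1 x x.2 i) hB) hB) hB)

lemma pbC2Norm_nonneg (Ω : Set (EuclideanSpace ℝ (Fin n)))
    (v : EuclideanSpace ℝ (Fin n) → EuclideanSpace ℝ (Fin m)) : 0 ≤ pbC2Norm Ω v :=
  Finset.sum_nonneg fun _ _ => Real.iSup_nonneg fun _ => Real.iSup_nonneg fun _ =>
    Real.iSup_nonneg fun _ => norm_nonneg _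

lemma C1HolderNorm_nonneg (α : ℝ) (Ω : Set (EuclideanSpace ℝ (Fin n)))
    (v : EuclideanSpace ℝ (Fin n) → EuclideanSpace ℝ (Fin m)) : 0 ≤ C1HolderNorm α Ω v :=
  add_nonneg (add_nonneg (Real.iSup_nonneg fun _ => norm_nonneg _)
    (Real.iSup_nonneg fun _ => norm_nonneg _)) (Real.iSup_nonneg fun _ => by positivity)

lemma fderiv_eq_zero_of_C1HolderNorm_eq_zero {α : ℝ} {Ω : Set (EuclideanSpace ℝ (Fin n))}
    {v : EuclideanSpace ℝ (Fin n) → EuclideanSpace ℝ (Fin m)}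
    (hvH : ∃ C : ℝ, ∀ x ∈ Ω, ∀ y ∈ Ω, ‖fderiv ℝ v x - fderiv ℝ v y‖ ≤ C * ‖x - y‖ ^ α)
    (h : C1HolderNorm α Ω v = 0) : ∀ x ∈ Ω, fderiv ℝ v x = 0 := by
  obtain ⟨C, hC⟩ := hvH
  intro x hx
  have h1 : 0 ≤ ⨆ x : Ω, ‖v x‖ := Real.iSup_nonneg fun _ => norm_nonneg _
  have h2 : 0 ≤ ⨆ x : Ω, ‖fderiv ℝ v x‖ := Real.iSup_nonneg fun _ => norm_nonneg _
  set q : ↥(Ω ×ˢ Ω) → ℝ := fun p => ‖fderiv ℝ v p.1.1 - fderiv ℝ v p.1.2‖ /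
    ‖p.1.1 - p.1.2‖ ^ α with hq
  have h3 : 0 ≤ ⨆ p, q p := Real.iSup_nonneg fun _ => by positivity
  have h : (⨆ x : Ω, ‖v x‖) + (⨆ x : Ω, ‖fderiv ℝ v x‖) + (⨆ p, q p) = 0 := h
  have hqb : BddAbove (range q) := by
    refine ⟨max C 0, ?_⟩
    rintro _ ⟨p, rfl⟩
    refine div_le_of_le_mul₀ (by positivity) (le_max_right _ _) ((hC _ p.2.1 _ p.2.2).trans ?_)
    gcongr
    exact le_max_left _ _
  have hconst : ∀ y ∈ Ω, fderiv ℝ v y = fderiv ℝ v x := fun y hy => by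
    by_cases hyx : y = x
    · rw [hyx]
    have hle : q ⟨(y, x), hy, hx⟩ ≤ 0 := (le_ciSup hqb _).trans (by linarith)
    have hpos : 0 < ‖y - x‖ ^ α := Real.rpow_pos_of_pos (norm_pos_iff.2 (sub_ne_zero.2 hyx)) α
    have := (div_le_iff₀ hpos).1 hle
    rw [zero_mul] at this
    exact sub_eq_zero.1 (norm_le_zero_iff.1 this)
  have hbd : BddAbove (range fun x : Ω => ‖fderiv ℝ v x‖) := by
    refine ⟨‖fderiv ℝ v x‖, ?_⟩
    rintro _ ⟨y, rfl⟩
    exact (congrArg norm (hconst y y.2)).le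
  exact norm_le_zero_iff.1 ((le_ciSup hbd ⟨x, hx⟩).trans (by linarith))

end Main

set_option maxHeartbeats 1000000 in
/-- **Quadratic estimate for regularizations** (Proposition 1 of
Conti–De Lellis–Székelyhidi): if `v ∈ C^{1,α}` and `v^♯e ∈ C²`, then
`‖(v*φ_ℓ)^♯e − v^♯e‖_{C¹(K)} = O(ℓ^{2α−1})`. -/
theorem quadratic_estimate_mollification
    (n m : ℕ) (Ω : Set (EuclideanSpace ℝ (Fin n))) (hΩ : IsOpen Ω)
    (α : ℝ) (hα0 : 0 < α) (hα1 : α ≤ 1)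
    (v : EuclideanSpace ℝ (Fin n) → EuclideanSpace ℝ (Fin m))
    (hv : ContDiffOn ℝ 1 v Ω)
    (hvH : ∃ C : ℝ, ∀ x ∈ Ω, ∀ y ∈ Ω, ‖fderiv ℝ v x - fderiv ℝ v y‖ ≤ C * ‖x - y‖ ^ α)
    (hpb : ∀ i j, ContDiffOn ℝ 2 (fun y => pullbackE v y i j) Ω)
    (φ : EuclideanSpace ℝ (Fin n) → ℝ)
    (hφsmooth : ContDiff ℝ (⊤ : ℕ∞) φ) (hφsupp : HasCompactSupport φ)
    (hφsymm : ∀ x, φ (-x) = φ x) (hφint : ∫ x, φ x = 1)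
    (K : Set (EuclideanSpace ℝ (Fin n))) (hK : IsCompact K) (hKΩ : K ⊆ Ω) :
    ∃ C > (0 : ℝ), ∃ ℓ₀ > (0 : ℝ), ∀ ℓ : ℝ, 0 < ℓ → ℓ ≤ ℓ₀ →
      matC1On K (fun x => pullbackE (convVec (moll φ ℓ) v) x - pullbackE v x) ≤
          C * ℓ ^ (2 * α - 1) ∧
      matC1On K (fun x => pullbackE (convVec (moll φ ℓ) v) x - pullbackE v x) ≤
          C * (ℓ ^ (2 * α - 1) * (C1HolderNorm α Ω v) ^ 2 + ℓ * pbC2Norm Ω v) := by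
  obtain ⟨δ, hδ, χ, hχ, hχs, hχΩ, hUΩ, hχ1⟩ := exists_cutoff hK hΩ hKΩ
  obtain ⟨R, hR, hφR⟩ : ∃ R > (0 : ℝ), ∀ z, φ z ≠ 0 → ‖z‖ ≤ R := by
    obtain ⟨R, hR, hsub⟩ := hφsupp.isCompact.isBounded.subset_closedBall_lt 0 0
    exact ⟨R, hR, fun z hz => mem_closedBall_zero_iff.1 (hsub (subset_tsupport _ hz))⟩
  obtain ⟨H, hH0, hH⟩ : ∃ H ≥ (0 : ℝ), ∀ x ∈ Ω, ∀ y ∈ Ω,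
      ‖fderiv ℝ v x - fderiv ℝ v y‖ ≤ H * ‖x - y‖ ^ α := by
    obtain ⟨C, hC⟩ := hvH
    refine ⟨max C 0, le_max_right _ _, fun x hx y hy => (hC x hx y hy).trans ?_⟩
    gcongr
    exact le_max_left _ _
  have hφ1 : ContDiff ℝ 1 φ := hφsmooth.of_le (by simp)
  set U := Metric.thickening (2 * δ) K
  set V := Metric.thickening δ K
  have hVo : IsOpen V := Metric.isOpen_thickening
  have hKV : K ⊆ V := Metric.self_subset_thickening hδ K
  have hVU : V ⊆ U := Metric.thickening_mono (by linarith) K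
  set v₀ : EuclideanSpace ℝ (Fin n) → EuclideanSpace ℝ (Fin m) := fun x => χ x • v x with hv₀def
  have hv₀ : ContDiff ℝ 1 v₀ :=
    contDiff_smul_of_tsupport_subset hΩ (hχ.of_le (by simp)) hχΩ hv
  have hv₀s : HasCompactSupport v₀ := hχs.smul_right
  have hvv₀ : ∀ x ∈ U, v x = v₀ x := fun x hx => by simp [hv₀def, hχ1 x hx]
  have hDv : ∀ x ∈ U, fderiv ℝ v x = fderiv ℝ v₀ x := fun x hx =>
    Filter.EventuallyEq.fderiv_eq <| by
      filter_upwards [Metric.isOpen_thickening.mem_nhds hx] with z hz using hvv₀ z hz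
  set a : Fin n → EuclideanSpace ℝ (Fin n) → EuclideanSpace ℝ (Fin m) :=
    fun i y => fderiv ℝ v₀ y (EuclideanSpace.single i 1) with hadef
  have ha : ∀ i, Continuous (a i) := fun i =>
    (hv₀.continuous_fderiv one_ne_zero).clm_apply continuous_const
  set g : Fin n → Fin n → EuclideanSpace ℝ (Fin n) → ℝ :=
    fun i j x => χ x • pullbackE v x i j with hgdef
  have hg : ∀ i j, ContDiff ℝ 2 (g i j) := fun i j =>
    contDiff_smul_of_tsupport_subset hΩ (hχ.of_le (WithTop.coe_le_coe.2 le_top)) hχΩ (hpb i j)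
  have hgs : ∀ i j, HasCompactSupport (g i j) := fun i j => hχs.smul_right
  have hg1 : ∀ i j, ContDiff ℝ 1 (g i j) := fun i j => (hg i j).of_le one_le_two
  have hgU : ∀ i j, ∀ x ∈ U, g i j x = pullbackE v x i j := fun i j x hx => by
    simp [hgdef, hχ1 x hx]
  have hagU : ∀ i j, ∀ x ∈ U, ⟪a i x, a j x⟫ = g i j x := fun i j x hx => by
    simp only [hgU i j x hx, hadef, ← hDv x hx, pullbackE, Matrix.of_apply]
  choose Λ₀ hΛ₀ hgΛ₀ using fun i j =>
    (hg1 i j).exists_lipschitz_of_hasCompactSupport (hgs i j)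
  choose Λ₁ hΛ₁ hgΛ₁ using fun i j =>
    ((hg i j).fderiv_right (m := 1) le_rfl).exists_lipschitz_of_hasCompactSupport
      ((hgs i j).fderiv ℝ)
  set Λ : ℝ := ∑ i, ∑ j, (Λ₀ i j + Λ₁ i j)
  have hΛle : ∀ i j, Λ₀ i j + Λ₁ i j ≤ Λ := fun i j =>
    (Finset.single_le_sum (f := fun j => Λ₀ i j + Λ₁ i j)
      (fun j _ => add_nonneg (hΛ₀ i j) (hΛ₁ i j)) (Finset.mem_univ j)).trans
    (Finset.single_le_sum (f := fun i => ∑ j, (Λ₀ i j + Λ₁ i j))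
      (fun i _ => Finset.sum_nonneg fun j _ => add_nonneg (hΛ₀ i j) (hΛ₁ i j))
      (Finset.mem_univ i))
  have hΛ : 0 ≤ Λ :=
    Finset.sum_nonneg fun i _ => Finset.sum_nonneg fun j _ => add_nonneg (hΛ₀ i j) (hΛ₁ i j)
  set M : ℝ := ∫ z, |φ z|
  have hM0 : 0 ≤ M := integral_nonneg fun _ => abs_nonneg _
  set N : ℝ := ∫ z, ‖fderiv ℝ φ z‖
  have hN0 : 0 ≤ N := integral_nonneg fun _ => norm_nonneg _
  have hball : ∀ ℓ, 0 < ℓ → ℓ ≤ min 1 (δ / R) → ℓ * R ≤ δ := fun ℓ _ hℓ =>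
    (le_div_iff₀ hR).1 (hℓ.trans (min_le_right _ _))
  have hentry : ∀ ℓ, 0 < ℓ → ℓ ≤ min 1 (δ / R) → ∀ i j, ∀ x ∈ V,
      (pullbackE (convVec (moll φ ℓ) v) x - pullbackE v x) i j =
        ⟪∫ y, moll φ ℓ (x - y) • a i y, ∫ y, moll φ ℓ (x - y) • a j y⟫ - g i j x := by
    intro ℓ hℓ hℓ₀ i j x hx
    have hψ := (tsupport_moll_subset hℓ hφR).trans
      (Metric.closedBall_subset_closedBall (hball ℓ hℓ hℓ₀))
    rw [hgU i j x (hVU hx), Matrix.sub_apply]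
    simp only [pullbackE, Matrix.of_apply,
      fderiv_convVec_apply (contDiff_moll hφ1).continuous hψ hv₀ hv₀s hvv₀ hx, hadef]
  have hDentry : ∀ ℓ, 0 < ℓ → ℓ ≤ min 1 (δ / R) → ∀ i j, ∀ x ∈ V,
      fderiv ℝ (fun y => (pullbackE (convVec (moll φ ℓ) v) y - pullbackE v y) i j) x =
        fderiv ℝ (fun x => ⟪∫ y, moll φ ℓ (x - y) • a i y, ∫ y, moll φ ℓ (x - y) • a j y⟫
          - g i j x) x := fun ℓ hℓ hℓ₀ i j x hx =>
    Filter.EventuallyEq.fderiv_eq <| by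
      filter_upwards [hVo.mem_nhds hx] with z hz using hentry ℓ hℓ hℓ₀ i j z hz
  set T : ℝ := H * R ^ α
  set C₀ : ℝ := (M ^ 2 + M) * T ^ 2 + M * Λ * R with hC₀
  set C₁ : ℝ := N * (2 * M + 1) * T ^ 2 + M * Λ * R with hC₁
  have hC₀0 : 0 ≤ C₀ := by positivity
  have hC₁0 : 0 ≤ C₁ := by positivity
  have hmain : ∀ ℓ, 0 < ℓ → ℓ ≤ min 1 (δ / R) →
      matC1On K (fun x => pullbackE (convVec (moll φ ℓ) v) x - pullbackE v x) ≤
        (C₀ + C₁) * ℓ ^ (2 * α - 1) := by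
    intro ℓ hℓ hℓ₀
    have hℓ1 : ℓ ≤ 1 := hℓ₀.trans (min_le_left _ _)
    have hpow : (ℓ ^ α) ^ 2 = ℓ * ℓ ^ (2 * α - 1) := by
      rw [← Real.rpow_natCast, ← Real.rpow_mul hℓ.le, Real.rpow_sub_one hℓ.ne',
        mul_div_cancel₀ _ hℓ.ne']
      norm_num [mul_comm]
    set P := ℓ ^ (2 * α - 1)
    have hP0 : 0 < P := Real.rpow_pos_of_pos hℓ _
    have hℓP : ℓ ≤ P := by
      simpa using Real.rpow_le_rpow_of_exponent_ge hℓ hℓ1 (by linarith : 2 * α - 1 ≤ 1)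
    have hosc : ∀ i, ∀ x ∈ K, ∀ y, ‖x - y‖ ≤ ℓ * R → ‖a i y - a i x‖ ≤ T * ℓ ^ α := by
      intro i x hx y hy
      have hxU : x ∈ U := hVU (hKV hx)
      have hyU : y ∈ U := mem_thickening_two_mul (hKV hx) (hy.trans (hball ℓ hℓ hℓ₀))
      calc ‖a i y - a i x‖ = ‖(fderiv ℝ v y - fderiv ℝ v x) (EuclideanSpace.single i 1)‖ := by
            rw [hDv x hxU, hDv y hyU, sub_apply]
        _ ≤ ‖fderiv ℝ v y - fderiv ℝ v x‖ := by
            simpa using (fderiv ℝ v y - fderiv ℝ v x).le_opNorm (EuclideanSpace.single i 1)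
        _ ≤ H * ‖y - x‖ ^ α := hH y (hUΩ hyU) x (hUΩ hxU)
        _ ≤ H * (ℓ * R) ^ α := by
            rw [norm_sub_rev]
            gcongr
        _ = T * ℓ ^ α := by rw [Real.mul_rpow hℓ.le hR.le]; ring
    have hest : ∀ i j, ∀ x ∈ K, _ := fun i j x hx =>
      inner_mollification_estimate (μ := volume) (contDiff_moll hφ1 (ℓ := ℓ))
        (HasCompactSupport.of_support_subset_isCompact (isCompact_closedBall 0 (ℓ * R))
          ((subset_tsupport _).trans (tsupport_moll_subset hℓ hφR)))
        ((integral_moll hℓ).trans hφint) (by positivity) (tsupport_moll_subset hℓ hφR)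
        (N := ℓ⁻¹ * N) (by positivity) (integral_abs_moll hℓ)
        (integral_abs_fderiv_moll_le hφ1 hφsupp hℓ) (ha i) (ha j) (hg1 i j) (hgs i j) hΛ
        (fun x y => (hgΛ₀ i j x y).trans <| by
          gcongr; linarith [hΛle i j, hΛ₁ i j])
        (fun x y => (hgΛ₁ i j x y).trans <| by
          gcongr; linarith [hΛle i j, hΛ₀ i j])
        (x := x) (S := T * ℓ ^ α)
        (fun y hy => hagU i j y
          (mem_thickening_two_mul (hKV hx) (hy.trans (hball ℓ hℓ hℓ₀))))
        (hosc i x hx) (hosc j x hx)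
    have hlin : M * Λ * (ℓ * R) ≤ M * Λ * R * P := by
      calc M * Λ * (ℓ * R) = M * Λ * R * ℓ := by ring
        _ ≤ M * Λ * R * P := by gcongr
    rw [add_mul]
    refine matC1On_le (by positivity) (by positivity) (fun x hx i j => ?_) fun x hx i j => ?_
    · rw [hentry ℓ hℓ hℓ₀ i j x (hKV hx)]
      refine (hest i j x hx).1.trans ?_
      have : (M ^ 2 + M) * T ^ 2 * (ℓ * P) ≤ (M ^ 2 + M) * T ^ 2 * P := by
        gcongr
        exact mul_le_of_le_one_left hP0.le hℓ1
      rw [mul_pow, hpow, hC₀]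
      linarith
    · rw [hDentry ℓ hℓ hℓ₀ i j x (hKV hx)]
      refine (hest i j x hx).2.trans ?_
      have : ℓ⁻¹ * N * (2 * M + 1) * (T ^ 2 * (ℓ * P)) = N * (2 * M + 1) * T ^ 2 * P := by
        field_simp
      rw [mul_pow, hpow, hC₁, this]
      linarith
  have hdegenerate : C1HolderNorm α Ω v = 0 → ∀ ℓ, 0 < ℓ → ℓ ≤ min 1 (δ / R) →
      matC1On K (fun x => pullbackE (convVec (moll φ ℓ) v) x - pullbackE v x) ≤ 0 := by
    intro h0 ℓ hℓ hℓ₀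
    have hD0 := fderiv_eq_zero_of_C1HolderNorm_eq_zero hvH h0
    have ha0 : ∀ i, ∀ x ∈ U, a i x = 0 := fun i x hx => by
      simp [hadef, ← hDv x hx, hD0 x (hUΩ hx)]
    have hz : ∀ i j, ∀ x ∈ V,
        (pullbackE (convVec (moll φ ℓ) v) x - pullbackE v x) i j = 0 := by
      intro i j x hx
      have hint : ∫ y, moll φ ℓ (x - y) • a i y = 0 := integral_eq_zero_of_ae <|
        .of_forall fun y => by
          by_cases hy : moll φ ℓ (x - y) = 0
          · simp [hy]
          · have hxy : ‖x - y‖ ≤ ℓ * R := by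
              simpa using tsupport_moll_subset hℓ hφR (subset_tsupport _ hy)
            simp [ha0 i y (mem_thickening_two_mul hx (hxy.trans (hball ℓ hℓ hℓ₀)))]
      rw [hentry ℓ hℓ hℓ₀ i j x hx, ← hagU i j x (hVU hx), ha0 i x (hVU hx), hint]
      simp
    rw [← add_zero (0 : ℝ)]
    refine matC1On_le le_rfl le_rfl (fun x hx i j => by rw [hz i j x (hKV hx), abs_zero])
      fun x hx i j => ?_
    have hev : (fun y => (pullbackE (convVec (moll φ ℓ) v) y - pullbackE v y) i j)
        =ᶠ[nhds x] fun _ => 0 := by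
      filter_upwards [hVo.mem_nhds (hKV hx)] with z hzV using hz i j z hzV
    rw [hev.fderiv_eq]
    simp
  have hQ0 := C1HolderNorm_nonneg α Ω v
  have hP2 := pbC2Norm_nonneg Ω v
  set Q := C1HolderNorm α Ω v
  refine ⟨(C₀ + C₁ + 1) * (1 + (Q ^ 2)⁻¹), by positivity, min 1 (δ / R), by positivity,
    fun ℓ hℓ hℓ₀ => ⟨(hmain ℓ hℓ hℓ₀).trans ?_, ?_⟩⟩
  · gcongr
    nlinarith [inv_nonneg.2 (sq_nonneg Q)]
  · rcases hQ0.eq_or_lt' with h0 | hpos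
    · exact (hdegenerate h0 ℓ hℓ hℓ₀).trans (by positivity)
    · calc _ ≤ (C₀ + C₁) * ℓ ^ (2 * α - 1) := hmain ℓ hℓ hℓ₀
        _ ≤ (C₀ + C₁ + 1) * ((Q ^ 2)⁻¹ * Q ^ 2) * ℓ ^ (2 * α - 1) := by
            rw [inv_mul_cancel₀ (by positivity), mul_one]
            exact mul_le_mul_of_nonneg_right (by linarith) (by positivity)
        _ = (C₀ + C₁ + 1) * (Q ^ 2)⁻¹ * (ℓ ^ (2 * α - 1) * Q ^ 2) := by ring
        _ ≤ (C₀ + C₁ + 1) * (1 + (Q ^ 2)⁻¹) *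
            (ℓ ^ (2 * α - 1) * Q ^ 2 + ℓ * pbC2Norm Ω v) := by
            gcongr
            · linarith
            · exact le_add_of_nonneg_right (by positivity)
end
end

section
/- Define J₀(τ) = (1/2π) ∫₀^{2π} cos(τ sin t) dt for τ ∈ ℝ. There exist δ > 0 and a function f ∈ C^∞((−δ, δ)) with f(0) = 0 and f′(0) = √2 such that J₀(f(s)) = 1/√(1+s²) for all s ∈ (−δ, δ). -/
open Set Real intervalIntegral

noncomputable section

/-- The Bessel function `J₀(τ) = (1/2π) ∫₀^{2π} cos(τ sin t) dt`. -/
def J0 (τ : ℝ) : ℝ :=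
  (1 / (2 * π)) * ∫ t in (0 : ℝ)..(2 * π), Real.cos (τ * Real.sin t)

open Filter Topology
open scoped ContDiff

/-- Averaging an entire function along `z ↦ z * u t` against a continuous weight gives an
entire function. -/
lemma differentiable_intervalIntegral_mul_comp_mul {G : ℂ → ℂ} (hG : Differentiable ℂ G)
    {w u : ℝ → ℂ} (hw : Continuous w) (hu : Continuous u) (a b : ℝ) :
    Differentiable ℂ fun z => ∫ t in a..b, w t * G (z * u t) := by
  intro z₀
  have hG' : Continuous (deriv G) := (hG.contDiff (n := 1)).continuous_deriv le_rfl
  have hF (z : ℂ) : Continuous fun t => w t * G (z * u t) :=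
    hw.mul (hG.continuous.comp (continuous_const.mul hu))
  have hF' : Continuous fun p : ℂ × ℝ => w p.2 * (deriv G (p.1 * u p.2) * u p.2) := by
    fun_prop
  obtain ⟨C, hC⟩ := ((isCompact_closedBall z₀ 1).prod
    (isCompact_uIcc (a := a) (b := b))).exists_bound_of_continuousOn hF'.continuousOn
  refine (intervalIntegral.hasDerivAt_integral_of_dominated_loc_of_deriv_le
    (F' := fun z t => w t * (deriv G (z * u t) * u t)) (bound := fun _ => C)
    (Metric.closedBall_mem_nhds z₀ one_pos)
    (Eventually.of_forall fun z => (hF z).aestronglyMeasurable)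
    ((hF z₀).intervalIntegrable _ _)
    (hF'.comp (Continuous.prodMk_right z₀)).aestronglyMeasurable ?_
    intervalIntegrable_const ?_).2.differentiableAt
  · exact Eventually.of_forall fun t ht z hz => hC (z, t) ⟨hz, uIoc_subset_uIcc ht⟩
  · refine Eventually.of_forall fun t _ z _ => ?_
    have h := (hG (z * u t)).hasDerivAt.comp z ((hasDerivAt_id z).mul_const (u t))
    simpa using h.const_mul (w t)

lemma differentiable_dslope_sin : Differentiable ℂ (dslope Complex.sin 0) :=
  differentiableOn_univ.1 <| (Complex.differentiableOn_dslope univ_mem).2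
    Complex.differentiable_sin.differentiableOn

lemma mul_dslope_sin (z : ℂ) : z * dslope Complex.sin 0 z = Complex.sin z := by
  simpa using sub_smul_dslope Complex.sin 0 z

/-- `J0 τ = 1 - τ ^ 2 * h τ` for a function `h` analytic at the origin with `h 0 = 1 / 4`. -/
lemma exists_J0_eq_one_sub_sq_mul :
    ∃ h : ℝ → ℝ, ContDiffAt ℝ ω h 0 ∧ h 0 = 1 / 4 ∧ ∀ x, J0 x = 1 - x ^ 2 * h x := by
  set H : ℂ → ℂ := fun z => ∫ t in (0 : ℝ)..(2 * π),
    ((sin t ^ 2 / 2 : ℝ) : ℂ) * (dslope Complex.sin 0 (z * ((sin t / 2 : ℝ) : ℂ))) ^ 2 with hH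
  have hHd : Differentiable ℂ H :=
    differentiable_intervalIntegral_mul_comp_mul (differentiable_dslope_sin.pow 2)
      (by fun_prop) (by fun_prop) _ _
  have hH0 : H 0 = ((π / 2 : ℝ) : ℂ) := by
    have : ∫ t in (0 : ℝ)..(2 * π), sin t ^ 2 / 2 = π / 2 := by
      rw [intervalIntegral.integral_div, integral_sin_sq]
      simp
    rw [← this, ← intervalIntegral.integral_ofReal]
    simp [hH]
  have key (x : ℝ) : (x : ℂ) ^ 2 * H x = ((2 * π - 2 * π * J0 x : ℝ) : ℂ) := by
    have e : 2 * π - 2 * π * J0 x = ∫ t in (0 : ℝ)..(2 * π), (1 - cos (x * sin t)) := by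
      rw [intervalIntegral.integral_sub intervalIntegrable_const
        ((by fun_prop : Continuous fun t => cos (x * sin t)).intervalIntegrable _ _), J0]
      simp
      field_simp
    rw [e, ← intervalIntegral.integral_ofReal, hH, ← intervalIntegral.integral_const_mul]
    refine intervalIntegral.integral_congr fun t _ => ?_
    have h1 := mul_dslope_sin ((x : ℂ) * ((sin t / 2 : ℝ) : ℂ))
    have h2 := Complex.cos_two_mul ((x : ℂ) * ((sin t / 2 : ℝ) : ℂ))
    have h3 := Complex.sin_sq_add_cos_sq ((x : ℂ) * ((sin t / 2 : ℝ) : ℂ))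
    have h4 : 2 * ((x : ℂ) * ((sin t / 2 : ℝ) : ℂ)) = ((x * sin t : ℝ) : ℂ) := by
      push_cast; ring
    rw [h4] at h2
    rw [← h1] at h3
    push_cast at h2 h3 ⊢
    linear_combination 2 * h3 + h2
  refine ⟨fun x => (H x).re / (2 * π), ?_, ?_, fun x => ?_⟩
  · have h1 : ContDiffAt ℝ ω H ((0 : ℝ) : ℂ) := (hHd.contDiff.restrict_scalars ℝ).contDiffAt
    have h2 : ContDiffAt ℝ ω (fun x : ℝ => H x) 0 :=
      h1.comp (0 : ℝ) Complex.ofRealCLM.contDiff.contDiffAt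
    exact (Complex.reCLM.contDiff.contDiffAt.comp (0 : ℝ) h2).div_const _
  · simp only [Complex.ofReal_zero, hH0, Complex.ofReal_re]
    field_simp
    norm_num
  · have h := congrArg Complex.re (key x)
    rw [← Complex.ofReal_pow, Complex.re_ofReal_mul, Complex.ofReal_re] at h
    field_simp
    linarith

/-- The inverse function theorem at the origin, for functions of one real variable. -/
lemma exists_contDiffAt_local_right_inverse {φ : ℝ → ℝ} {c : ℝ} (hφ : ContDiffAt ℝ ω φ 0)
    (h0 : φ 0 = 0) (hd : HasDerivAt φ c 0) (hc : c ≠ 0) :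
    ∃ g : ℝ → ℝ, ContDiffAt ℝ ω g 0 ∧ g 0 = 0 ∧ HasDerivAt g c⁻¹ 0 ∧
      ∀ᶠ y in 𝓝 0, φ (g y) = y := by
  have hω : (ω : WithTop ℕ∞) ≠ 0 := by simp
  have hs := hφ.hasStrictDerivAt' hd hω
  have hf := (hs.hasStrictFDerivAt_equiv hc).hasFDerivAt
  have hg' : HasDerivAt (hφ.localInverse hf hω) c⁻¹ (φ 0) := (hs.to_localInverse hc).hasDerivAt
  have hinv : ∀ᶠ y in 𝓝 (φ 0), φ (hφ.localInverse hf hω y) = y :=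
    (hs.hasStrictFDerivAt_equiv hc).eventually_right_inverse
  have hg := hφ.to_localInverse hf hω
  have hg0 := hφ.localInverse_apply_image hf hω
  rw [h0] at hg' hinv hg hg0
  exact ⟨_, hg, hg0, hg', hinv⟩

/-- If `h` is analytic and positive at the origin, so is `x ↦ x * √(h x)` there, with derivative
`√(h 0)`. -/
lemma contDiffAt_and_hasDerivAt_mul_sqrt {h : ℝ → ℝ} (hh : ContDiffAt ℝ ω h 0) (h0 : 0 < h 0) :
    ContDiffAt ℝ ω (fun x => x * √(h x)) 0 ∧ HasDerivAt (fun x => x * √(h x)) (√(h 0)) 0 := by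
  have hs : ContDiffAt ℝ ω (fun x => √(h x)) 0 := hh.sqrt h0.ne'
  refine ⟨contDiffAt_id.mul hs, ?_⟩
  simpa using (hasDerivAt_id' (0 : ℝ)).fun_mul (hs.differentiableAt (by simp)).hasDerivAt

lemma one_sub_one_div_sqrt_one_add_sq (s : ℝ) :
    1 / √(1 + s ^ 2) = 1 - s ^ 2 * (1 / (√(1 + s ^ 2) * (√(1 + s ^ 2) + 1))) := by
  have h : 0 < √(1 + s ^ 2) := by positivity
  have h2 : √(1 + s ^ 2) ^ 2 = 1 + s ^ 2 := sq_sqrt (by positivity)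
  field_simp
  linarith

/-- **Inversion of `J₀` near the origin** (claim in the proof of Lemma 3 of
Conti–De Lellis–Székelyhidi): there are `δ > 0` and a smooth function `f` on
`(−δ, δ)` with `f(0) = 0`, `f'(0) = √2` and `J₀(f(s)) = 1/√(1+s²)`. -/
theorem J0_inverse_exists :
    ∃ δ > (0 : ℝ), ∃ f : ℝ → ℝ,
      ContDiffOn ℝ (⊤ : ℕ∞) f (Ioo (-δ) δ) ∧
      f 0 = 0 ∧
      deriv f 0 = Real.sqrt 2 ∧
      ∀ s ∈ Ioo (-δ) δ, J0 (f s) = 1 / Real.sqrt (1 + s ^ 2) := by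
  obtain ⟨h, hh, h0, hJ⟩ := exists_J0_eq_one_sub_sq_mul
  set k : ℝ → ℝ := fun s => 1 / (√(1 + s ^ 2) * (√(1 + s ^ 2) + 1)) with hk
  have hkpos (s : ℝ) : 0 < k s := by positivity
  have hk0 : k 0 = 1 / 2 := by norm_num [hk]
  have hkc : ContDiffAt ℝ ω k 0 := by
    have hr : ContDiffAt ℝ ω (fun s : ℝ => √(1 + s ^ 2)) 0 :=
      ContDiffAt.sqrt (by fun_prop) (by norm_num)
    exact contDiffAt_const.div (hr.mul (hr.add contDiffAt_const)) (by positivity)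
  obtain ⟨hφ, hφ'⟩ := contDiffAt_and_hasDerivAt_mul_sqrt hh (by rw [h0]; norm_num)
  obtain ⟨hψ, hψ'⟩ := contDiffAt_and_hasDerivAt_mul_sqrt hkc (hkpos 0)
  set ψ : ℝ → ℝ := fun s => s * √(k s) with hψdef
  have hψ0 : ψ 0 = 0 := by simp [ψ]
  obtain ⟨g, hg, hg0, hg', hinv⟩ := exists_contDiffAt_local_right_inverse hφ (by simp) hφ'
    (by rw [h0]; positivity)
  rw [← hψ0] at hg hg' hinv
  have hf : ContDiffAt ℝ ω (g ∘ ψ) 0 := hg.comp 0 hψ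
  have hf0 : (g ∘ ψ) 0 = 0 := by simp [hψ0, hg0]
  have hpos : ∀ᶠ s in 𝓝 0, 0 < h ((g ∘ ψ) s) := by
    have : ContinuousAt (h ∘ (g ∘ ψ)) 0 :=
      ContinuousAt.comp (by rw [hf0]; exact hh.continuousAt) hf.continuousAt
    refine this.eventually (lt_mem_nhds ?_)
    rw [Function.comp_apply, hf0, h0]
    norm_num
  obtain ⟨δ, hδ, hball⟩ := Metric.eventually_nhds_iff_ball.1
    ((hf.eventually (by simp)).and (hpos.and (hψ.continuousAt.eventually hinv)))
  rw [Real.ball_eq_Ioo, zero_sub, zero_add] at hball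
  refine ⟨δ, hδ, g ∘ ψ, fun s hs => ((hball s hs).1.of_le le_top).contDiffWithinAt, hf0, ?_,
    fun s hs => ?_⟩
  · rw [(hg'.comp 0 hψ').deriv, hψ0, h0, hk0, ← sqrt_inv, ← sqrt_mul (by norm_num)]
    norm_num
  · obtain ⟨-, hp, he⟩ := hball s hs
    have he2 := congrArg (· ^ 2) he
    simp only [hψdef, mul_pow, sq_sqrt (hkpos s).le] at he2
    rw [hJ, one_sub_one_div_sqrt_one_add_sq, ← he2]
    simp only [Function.comp_apply, hψdef] at hp ⊢
    rw [sq_sqrt hp.le]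
end
end
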